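/- Let μ be a packed composition of type (k,n), and for any composition κ let f_κ denote the homogeneous component of degree |κ| of f*_κ (the ASEP polynomial). Suppose (a^ν_μ)_ν is a family of elements of K, indexed by the compositions ν that are permutations of the composition obtained from μ by replacing every entry equal to 1 by 0, such that f_μ = (∏_{i=1}^{k} x_i) · Σ_ν a^ν_μ f_{ν^−}, where ν^− := (max(ν_1−1,0),…,max(ν_n−1,0)). Then f*_μ(x_1,…,x_n) = ∏_{i=1}^{k}(x_i − t^{−n+1}) · Σ_ν a^ν_μ q^{|ν^−|} f*_{ν^−}(x_1/q,…,x_n/q). -/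

import Mathlib

open MvPolynomial

noncomputable section
open scoped Classical

/-- The field `K = ℚ(q,t)`. -/
abbrev K : Type := FractionRing (MvPolynomial (Fin 2) ℚ)

/-- The indeterminate `q` as an element of `K`. -/
def qq : K := algebraMap (MvPolynomial (Fin 2) ℚ) K (X 0)

/-- The indeterminate `t` as an element of `K`. -/
def tt : K := algebraMap (MvPolynomial (Fin 2) ℚ) K (X 1)

/-- The size `|ν|` of a composition. -/
def csize {n : ℕ} (ν : Fin n → ℕ) : ℕ := ∑ i, ν i

/-- `k_i(ν) = #{j < i : ν_j > ν_i} + #{j > i : ν_j ≥ ν_i}`. -/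
def kstat {n : ℕ} (ν : Fin n → ℕ) (i : Fin n) : ℕ :=
  Set.ncard {j : Fin n | j < i ∧ ν i < ν j} + Set.ncard {j : Fin n | i < j ∧ ν i ≤ ν j}

/-- The evaluation point `ν̃ = (q^{ν_i} t^{-k_i(ν)})_i`. -/
def evalPt {n : ℕ} (ν : Fin n → ℕ) : Fin n → K :=
  fun i => qq ^ ν i * tt ^ (-(kstat ν i : ℤ))

/-- Weakly decreasing composition. -/
def IsPartition {n : ℕ} (l : Fin n → ℕ) : Prop := ∀ i j : Fin n, i ≤ j → l j ≤ l i

/-- The action `σ·μ := μ ∘ σ⁻¹`. -/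
def permAct {n : ℕ} (σ : Equiv.Perm (Fin n)) (μ : Fin n → ℕ) : Fin n → ℕ := μ ∘ ⇑σ.symm

/-- `S_n(λ)`: the rearrangements of `λ`. -/
def Sn {n : ℕ} (l : Fin n → ℕ) : Set (Fin n → ℕ) :=
  {μ | ∃ σ : Equiv.Perm (Fin n), permAct σ l = μ}

/-- The rearrangements of `λ` as a `Finset`. -/
def SnFinset {n : ℕ} (l : Fin n → ℕ) : Finset (Fin n → ℕ) :=
  Finset.image (fun σ : Equiv.Perm (Fin n) => permAct σ l) Finset.univ

/-- The exponent `Finsupp` of the monomial `x^μ`. -/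
def expOf {n : ℕ} (μ : Fin n → ℕ) : Fin n →₀ ℕ := Finsupp.equivFunOnFinite.symm μ

/-- Characterization of the interpolation nonsymmetric Macdonald polynomial `E*_μ`. -/
def IsEstar {n : ℕ} (μ : Fin n → ℕ) (f : MvPolynomial (Fin n) K) : Prop :=
  f.totalDegree ≤ csize μ ∧ coeff (expOf μ) f = 1 ∧
    ∀ ν : Fin n → ℕ, csize ν ≤ csize μ → ν ≠ μ → eval (evalPt ν) f = 0

/-- The interpolation nonsymmetric Macdonald polynomial `E*_μ` (unique by Knop–Sahi). -/
def Estar {n : ℕ} (μ : Fin n → ℕ) : MvPolynomial (Fin n) K :=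
  if h : ∃ f, IsEstar μ f then h.choose else 0

/-- Characterization of the interpolation (symmetric) Macdonald polynomial `P*_λ`. -/
def IsPstar {n : ℕ} (l : Fin n → ℕ) (f : MvPolynomial (Fin n) K) : Prop :=
  f.IsSymmetric ∧ f.totalDegree ≤ csize l ∧ coeff (expOf l) f = 1 ∧
    ∀ ν : Fin n → ℕ, IsPartition ν → csize ν ≤ csize l → ν ≠ l → eval (evalPt ν) f = 0

/-- The interpolation Macdonald polynomial `P*_λ`. -/
def Pstar {n : ℕ} (l : Fin n → ℕ) : MvPolynomial (Fin n) K :=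
  if h : ∃ f, IsPstar l f then h.choose else 0

/-- The space `V*_λ`. -/
def Vstar {n : ℕ} (l : Fin n → ℕ) : Submodule K (MvPolynomial (Fin n) K) :=
  (restrictTotalDegree (Fin n) K (csize l)) ⊓
    ⨅ (ν : Fin n → ℕ) (_ : csize ν ≤ csize l ∧ ν ∉ Sn l),
      LinearMap.ker (aeval (R := K) (evalPt ν)).toLinearMap

/-- Exchange of the variables `x_i` and `x_j` in a polynomial. -/
def swapVars {n : ℕ} (i j : Fin n) (f : MvPolynomial (Fin n) K) : MvPolynomial (Fin n) K :=
  rename (Equiv.swap i j) f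

/-- Exact division of polynomials: the unique `g` with `a = b * g` when it exists. -/
def exactDiv {n : ℕ} (a b : MvPolynomial (Fin n) K) : MvPolynomial (Fin n) K :=
  if h : ∃ g, a = b * g then h.choose else 0

/-- The Hecke operator
`T f = t f − ((t x_i − x_j)/(x_i − x_j))·(f − s_i f)` (where `j = i+1`). -/
def hecke {n : ℕ} (i j : Fin n) (f : MvPolynomial (Fin n) K) : MvPolynomial (Fin n) K :=
  C tt * f - (C tt * X i - X j) * exactDiv (f - swapVars i j f) (X i - X j)

/-- The Coxeter length of a permutation (number of inversions). -/
def permLength {n : ℕ} (σ : Equiv.Perm (Fin n)) : ℕ :=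
  Set.ncard {p : Fin n × Fin n | p.1 < p.2 ∧ σ p.2 < σ p.1}

/-- The adjacent transposition `s_i = (i, i+1)` (0-indexed). -/
def adjSwap {n : ℕ} (i : {i : ℕ // i + 1 < n}) : Equiv.Perm (Fin n) :=
  Equiv.swap ⟨i.1, Nat.lt_of_succ_lt i.2⟩ ⟨i.1 + 1, i.2⟩

/-- The Hecke operator `T_i` for an adjacent transposition index. -/
def heckeAt {n : ℕ} (i : {i : ℕ // i + 1 < n}) :
    MvPolynomial (Fin n) K → MvPolynomial (Fin n) K :=
  hecke ⟨i.1, Nat.lt_of_succ_lt i.2⟩ ⟨i.1 + 1, i.2⟩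

/-- `T_{i_1} ⋯ T_{i_ℓ} f` for a word `w = [i_1, …, i_ℓ]`. -/
def Tword {n : ℕ} (w : List {i : ℕ // i + 1 < n}) (f : MvPolynomial (Fin n) K) :
    MvPolynomial (Fin n) K :=
  w.foldr heckeAt f

/-- `w` is a reduced word for `σ`. -/
def IsReducedWordOf {n : ℕ} (w : List {i : ℕ // i + 1 < n}) (σ : Equiv.Perm (Fin n)) : Prop :=
  (w.map adjSwap).prod = σ ∧ w.length = permLength σ

/-- `T_σ`, computed from a reduced word of `σ` (independent of the choice, by the
Hecke algebra relations). -/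
def Tsigma {n : ℕ} (σ : Equiv.Perm (Fin n)) :
    MvPolynomial (Fin n) K → MvPolynomial (Fin n) K :=
  if h : ∃ w, IsReducedWordOf w σ then Tword h.choose else id

/-- `σ_μ`: the (unique) shortest permutation with `σ·l = μ`. -/
def sigmaMin {n : ℕ} (l μ : Fin n → ℕ) : Equiv.Perm (Fin n) :=
  if h : ∃ σ, permAct σ l = μ ∧ ∀ τ, permAct τ l = μ → permLength σ ≤ permLength τ then
    h.choose else 1

/-- The weakly decreasing rearrangement of a composition. -/
def sortDesc {n : ℕ} (μ : Fin n → ℕ) : Fin n → ℕ :=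
  if h : ∃ l, IsPartition l ∧ μ ∈ Sn l then h.choose else μ

/-- The interpolation ASEP polynomial `f*_μ = T_{σ_μ} E*_λ`, where `λ` is the weakly
decreasing rearrangement of `μ`. -/
def fstar {n : ℕ} (μ : Fin n → ℕ) : MvPolynomial (Fin n) K :=
  Tsigma (sigmaMin (sortDesc μ) μ) (Estar (sortDesc μ))

/-- The composition with entries `i` and `j` exchanged. -/
def swapEntries {n : ℕ} (i j : Fin n) (μ : Fin n → ℕ) : Fin n → ℕ := μ ∘ ⇑(Equiv.swap i j)
/-- `μ` is packed of type `(k,n)`: nonzero entries exactly in the first `k` positions. -/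
def Packed {n : ℕ} (k : ℕ) (μ : Fin n → ℕ) : Prop :=
  ∀ i : Fin n, ((i : ℕ) < k → μ i ≠ 0) ∧ (k ≤ (i : ℕ) → μ i = 0)

/-- The (homogeneous) ASEP polynomial `f_κ`: the top homogeneous component of `f*_κ`. -/
def fhom {n : ℕ} (κ : Fin n → ℕ) : MvPolynomial (Fin n) K :=
  homogeneousComponent (csize κ) (fstar κ)

/-- Substitution `x_j ↦ x_j / q`. -/
def scaleQinv {n : ℕ} (f : MvPolynomial (Fin n) K) : MvPolynomial (Fin n) K :=
  aeval (fun j : Fin n => C qq⁻¹ * X j) f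

/-- `μ` with every entry equal to `1` replaced by `0`. -/
def zeroOnes {n : ℕ} (μ : Fin n → ℕ) : Fin n → ℕ := fun i => if μ i = 1 then 0 else μ i

/-- `ν⁻ = (max(ν_i − 1, 0))_i`. -/
def decOne {n : ℕ} (ν : Fin n → ℕ) : Fin n → ℕ := fun i => ν i - 1

/-! ### Arithmetic of `q` and `t` -/

theorem qq_ne : qq ≠ 0 := by
  unfold qq
  rw [Ne, FaithfulSMul.algebraMap_eq_zero_iff]
  exact X_ne_zero 0

theorem tt_ne : tt ≠ 0 := by
  unfold tt
  rw [Ne, FaithfulSMul.algebraMap_eq_zero_iff]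
  exact X_ne_zero 1

theorem qt_inj {a b c d : ℕ} (h : qq ^ a * tt ^ b = qq ^ c * tt ^ d) : a = c ∧ b = d := by
  unfold qq tt at h
  simp only [← map_pow, ← map_mul] at h
  have h2 := FaithfulSMul.algebraMap_injective (MvPolynomial (Fin 2) ℚ) K h
  rw [X_pow_eq_monomial, X_pow_eq_monomial, X_pow_eq_monomial, X_pow_eq_monomial,
    monomial_mul, monomial_mul, monomial_left_inj (by norm_num)] at h2
  have h0 := DFunLike.congr_fun h2 0
  have h1 := DFunLike.congr_fun h2 1
  simp at h0 h1
  exact ⟨h0, h1⟩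

theorem qt_inj_neg {a b c d : ℕ}
    (h : qq ^ a * tt ^ (-(b : ℤ)) = qq ^ c * tt ^ (-(d : ℤ))) : a = c ∧ b = d := by
  have ht := tt_ne
  simp only [zpow_neg, zpow_natCast] at h
  field_simp at h
  have := qt_inj (h.trans (mul_comm _ _))
  exact ⟨this.1, this.2.symm⟩

/-! ### Combinatorics of evaluation points -/

theorem kstat_eq {n : ℕ} (ν : Fin n → ℕ) (i : Fin n) :
    kstat ν i = ∑ j, if (j < i ∧ ν i < ν j) ∨ (i < j ∧ ν i ≤ ν j) then 1 else 0 := by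
  unfold kstat
  rw [Set.ncard_eq_toFinset_card', Set.ncard_eq_toFinset_card', ← Finset.card_union_of_disjoint,
    Finset.sum_boole]
  · simp only [Nat.cast_id]
    congr 1
    ext j
    simp
  · rw [Finset.disjoint_left]
    intro j
    simp only [Set.mem_toFinset, Set.mem_ofPred_eq]
    intro h1 h2
    exact absurd h1.1 (not_lt.mpr h2.1.le)

/-- `Φ κ = (κ_n + 1, κ_1, …, κ_{n-1})`. -/
def Phi {n : ℕ} (κ : Fin (n + 1) → ℕ) : Fin (n + 1) → ℕ :=
  Fin.cons (κ (Fin.last n) + 1) (fun i => κ i.castSucc)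

theorem csize_Phi {n : ℕ} (κ : Fin (n + 1) → ℕ) : csize (Phi κ) = csize κ + 1 := by
  unfold csize Phi
  rw [Fin.sum_univ_succ, Fin.sum_univ_castSucc (f := κ)]
  simp
  ring

theorem exists_Phi {n : ℕ} (η : Fin (n + 1) → ℕ) (h : η 0 ≠ 0) : ∃ κ, η = Phi κ := by
  refine ⟨Fin.snoc (fun i => η i.succ) (η 0 - 1), ?_⟩
  funext i
  refine Fin.cases ?_ (fun i => ?_) i
  · simp [Phi]; omega
  · simp [Phi]

theorem kstat_Phi_zero {n : ℕ} (κ : Fin (n + 1) → ℕ) :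
    kstat (Phi κ) 0 = kstat κ (Fin.last n) := by
  rw [kstat_eq, kstat_eq, Fin.sum_univ_succ, Fin.sum_univ_castSucc]
  have h : ∀ x : Fin n, ¬ Fin.last n < x.castSucc := fun x => not_lt.mpr (Fin.le_last _)
  simp [Phi, Fin.castSucc_lt_last, h]

theorem kstat_Phi_succ {n : ℕ} (κ : Fin (n + 1) → ℕ) (i : Fin n) :
    kstat (Phi κ) i.succ = kstat κ i.castSucc := by
  rw [kstat_eq, kstat_eq, Fin.sum_univ_succ, Fin.sum_univ_castSucc]
  have h : ∀ x : Fin n, ¬ Fin.last n < x.castSucc := fun x => not_lt.mpr (Fin.le_last _)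
  simp [Phi, Fin.castSucc_lt_last, h]
  rw [add_comm]

theorem evalPt_Phi {n : ℕ} (κ : Fin (n + 1) → ℕ) :
    evalPt (Phi κ) = Fin.cons (qq * evalPt κ (Fin.last n)) (fun i => evalPt κ i.castSucc) := by
  funext i
  refine Fin.cases ?_ (fun i => ?_) i
  · simp only [evalPt, kstat_Phi_zero, Fin.cons_zero]
    simp [Phi]
    ring
  · simp only [evalPt, kstat_Phi_succ, Fin.cons_succ]
    simp [Phi]

theorem kstat_zero {n : ℕ} (η : Fin (n + 1) → ℕ) (h : η 0 = 0) : kstat η 0 = n := by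
  rw [kstat_eq, Fin.sum_univ_succ]
  simp [h]

theorem evalPt_zero {n : ℕ} (η : Fin (n + 1) → ℕ) (h : η 0 = 0) :
    evalPt η 0 = tt ^ (-(n : ℤ)) := by
  simp [evalPt, kstat_zero η h, h]

theorem evalPt_zero_ne {n : ℕ} (η : Fin (n + 1) → ℕ) (h : η 0 ≠ 0) :
    evalPt η 0 ≠ tt ^ (-(n : ℤ)) := by
  intro h2
  have h3 : qq ^ (η 0) * tt ^ (-(kstat η 0 : ℤ)) = qq ^ 0 * tt ^ (-(n : ℤ)) := by
    rw [pow_zero, one_mul]; exact h2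
  exact h (qt_inj_neg h3).1

theorem evalPt_ne_zero {n : ℕ} (η : Fin n → ℕ) (i : Fin n) : evalPt η i ≠ 0 :=
  mul_ne_zero (pow_ne_zero _ qq_ne) (zpow_ne_zero _ tt_ne)

theorem evalPt_cons {n : ℕ} (η : Fin n → ℕ) :
    evalPt (Fin.cons 0 η : Fin (n + 1) → ℕ) = Fin.cons (tt ^ (-(n : ℤ))) (evalPt η) := by
  funext i
  refine Fin.cases ?_ (fun i => ?_) i
  · rw [evalPt_zero _ (by simp)]; simp
  · simp only [evalPt, Fin.cons_succ]
    congr 3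
    rw [kstat_eq, kstat_eq, Fin.sum_univ_succ]
    simp

theorem kstat_swap {n : ℕ} (η : Fin n → ℕ) (a b : Fin n) (hab : (a : ℕ) + 1 = b)
    (hne : η a ≠ η b) (i : Fin n) :
    kstat (η ∘ Equiv.swap a b) i = kstat η (Equiv.swap a b i) := by
  rw [kstat_eq, kstat_eq, ← Equiv.sum_comp (Equiv.swap a b)]
  refine Finset.sum_congr rfl fun j _ => ?_
  simp only [Function.comp, Equiv.swap_apply_self]
  congr 1
  have hlt : a < b := by rw [Fin.lt_def]; omega
  have hout : ∀ x : Fin n, x ≠ a → x ≠ b → ((x < a ↔ x < b) ∧ (a < x ↔ b < x)) := by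
    intro x h1 h2
    simp only [Fin.lt_def, ne_eq, Fin.ext_iff] at *
    omega
  have hnlt : ¬ b < a := not_lt.mpr hlt.le
  by_cases hia : i = a
  · subst hia
    by_cases hja : j = i
    · subst hja; simp [hlt, hnlt]; omega
    by_cases hjb : j = b
    · subst hjb
      simp only [Equiv.swap_apply_left, Equiv.swap_apply_right, eq_iff_iff]
      simp
    · rw [Equiv.swap_apply_of_ne_of_ne hja hjb, Equiv.swap_apply_left, (hout j hja hjb).1,
        (hout j hja hjb).2]
  · by_cases hib : i = b
    · subst hib
      by_cases hja : j = a
      · subst hja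
        simp only [Equiv.swap_apply_left, Equiv.swap_apply_right, eq_iff_iff]
        simp
      by_cases hjb : j = i
      · subst hjb; simp [hlt, hnlt]; omega
      · rw [Equiv.swap_apply_of_ne_of_ne hja hjb, Equiv.swap_apply_right, (hout j hja hjb).1,
          (hout j hja hjb).2]
    · rw [Equiv.swap_apply_of_ne_of_ne hia hib]
      by_cases hja : j = a
      · subst hja
        rw [Equiv.swap_apply_left, (hout i hia hib).1, (hout i hia hib).2]
      by_cases hjb : j = b
      · subst hjb
        rw [Equiv.swap_apply_right, (hout i hia hib).1, (hout i hia hib).2]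
      · rw [Equiv.swap_apply_of_ne_of_ne hja hjb]

theorem kstat_eq_add {n : ℕ} (η : Fin n → ℕ) (a b : Fin n) (hab : (a : ℕ) + 1 = b)
    (he : η a = η b) : kstat η a = kstat η b + 1 := by
  rw [kstat_eq, kstat_eq]
  have : (1 : ℕ) = ∑ j : Fin n, if j = b then 1 else 0 := by simp
  rw [this, ← Finset.sum_add_distrib]
  refine Finset.sum_congr rfl fun j _ => ?_
  simp only [Fin.ext_iff, Fin.lt_def] at *
  have hjb : (j : ℕ) = b → η j = η b := fun h => by rw [Fin.ext h]
  have hja : (j : ℕ) = a → η j = η a := fun h => by rw [Fin.ext h]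
  split_ifs <;> grind

theorem evalPt_swap {n : ℕ} (η : Fin n → ℕ) (a b : Fin n) (hab : (a : ℕ) + 1 = b)
    (hne : η a ≠ η b) : evalPt η ∘ Equiv.swap a b = evalPt (η ∘ Equiv.swap a b) := by
  funext i
  simp only [evalPt, Function.comp]
  rw [← kstat_swap η a b hab hne]

theorem evalPt_eq {n : ℕ} (η : Fin n → ℕ) (a b : Fin n) (hab : (a : ℕ) + 1 = b)
    (he : η a = η b) : tt * evalPt η a = evalPt η b := by
  simp only [evalPt, kstat_eq_add η a b hab he, he]
  have := tt_ne
  simp only [zpow_neg, zpow_natCast]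
  field_simp
  ring

theorem evalPt_adj_ne {n : ℕ} (η : Fin n → ℕ) (a b : Fin n) (hab : (a : ℕ) + 1 = b) :
    evalPt η a ≠ evalPt η b := by
  intro h
  have := qt_inj_neg h
  have h2 := kstat_eq_add η a b hab this.1
  omega

/-! ### Polynomial generalities -/

theorem dvd_algHom_sub {n : ℕ} (p : MvPolynomial (Fin n) K)
    (φ ψ : MvPolynomial (Fin n) K →ₐ[K] MvPolynomial (Fin n) K)
    (h : ∀ l, p ∣ φ (X l) - ψ (X l)) (f : MvPolynomial (Fin n) K) : p ∣ φ f - ψ f := by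
  have key : (Ideal.Quotient.mkₐ K (Ideal.span {p})).comp φ =
      (Ideal.Quotient.mkₐ K (Ideal.span {p})).comp ψ := by
    apply algHom_ext
    intro l
    simp only [AlgHom.comp_apply, Ideal.Quotient.mkₐ_eq_mk]
    rw [Ideal.Quotient.eq, Ideal.mem_span_singleton]
    exact h l
  have := DFunLike.congr_fun key f
  simp only [AlgHom.comp_apply, Ideal.Quotient.mkₐ_eq_mk] at this
  rwa [Ideal.Quotient.eq, Ideal.mem_span_singleton] at this

theorem dvd_sub_swap {n : ℕ} (i j : Fin n) (f : MvPolynomial (Fin n) K) :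
    (X i - X j) ∣ f - swapVars i j f := by
  refine dvd_algHom_sub (X i - X j) (AlgHom.id K _) (rename (Equiv.swap i j)) ?_ f
  intro l
  simp only [AlgHom.id_apply, rename_X]
  by_cases hi : l = i
  · subst hi; rw [Equiv.swap_apply_left]
  by_cases hj : l = j
  · subst hj; rw [Equiv.swap_apply_right]
    exact ⟨-1, by ring⟩
  · rw [Equiv.swap_apply_of_ne_of_ne hi hj]; simp

theorem exactDiv_spec {n : ℕ} (i j : Fin n) (f : MvPolynomial (Fin n) K) :
    f - swapVars i j f = (X i - X j) * exactDiv (f - swapVars i j f) (X i - X j) := by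
  have h : ∃ g, f - swapVars i j f = (X i - X j) * g := dvd_sub_swap i j f
  unfold exactDiv
  rw [dif_pos h]
  exact h.choose_spec

theorem dvd_of_vanish {n : ℕ} (c : K) (f : MvPolynomial (Fin (n + 1)) K)
    (h : ∀ y : Fin n → K, eval (Fin.cons c y : Fin (n + 1) → K) f = 0) :
    (X 0 - C c) ∣ f := by
  have h1 := dvd_algHom_sub (X 0 - C c) (AlgHom.id K _)
    (aeval (Fin.cons (C c) (fun i : Fin n => X i.succ) :
      Fin (n + 1) → MvPolynomial (Fin (n + 1)) K)) (by
      intro l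
      refine Fin.cases ?_ (fun l => ?_) l
      · simp
      · simp) f
  have h2 : aeval (Fin.cons (C c) (fun i : Fin n => X i.succ) :
      Fin (n + 1) → MvPolynomial (Fin (n + 1)) K) f = 0 := by
    apply MvPolynomial.funext
    intro x
    rw [aeval_def, map_zero]
    have := eval₂_comp_left (eval x) (algebraMap K (MvPolynomial (Fin (n + 1)) K))
      (Fin.cons (C c) (fun i : Fin n => X i.succ) : Fin (n + 1) → MvPolynomial (Fin (n + 1)) K) f
    rw [this, ← h (fun i => x i.succ)]
    have e1 : (eval x).comp (algebraMap K (MvPolynomial (Fin (n + 1)) K)) = RingHom.id K := by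
      ext a; simp [algebraMap_eq]
    rw [e1]
    unfold eval
    simp only [coe_eval₂Hom]
    congr 1
    funext i
    refine Fin.cases ?_ (fun i => ?_) i <;> simp
  rw [h2, sub_zero] at h1
  exact h1

theorem eval_aeval' {n m : ℕ} (y : Fin m → K) (g : Fin n → MvPolynomial (Fin m) K)
    (f : MvPolynomial (Fin n) K) : eval y (aeval g f) = eval (fun i => eval y (g i)) f := by
  rw [aeval_def, eval₂_comp_left (eval y)]
  have e1 : (eval y).comp (algebraMap K (MvPolynomial (Fin m) K)) = RingHom.id K := by
    ext a; simp [algebraMap_eq]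
  rw [e1]
  rfl

theorem totalDegree_aeval_le {n m : ℕ} (g : Fin n → MvPolynomial (Fin m) K)
    (hg : ∀ i, (g i).totalDegree ≤ 1) (f : MvPolynomial (Fin n) K) :
    (aeval g f).totalDegree ≤ f.totalDegree := by
  conv_lhs => rw [f.as_sum]
  rw [map_sum]
  refine totalDegree_finsetSum_le fun s hs => ?_
  rw [aeval_monomial]
  refine (totalDegree_mul _ _).trans ?_
  rw [algebraMap_eq, totalDegree_C, zero_add]
  refine le_trans ?_ (le_totalDegree hs)
  refine (totalDegree_finsetProd _ _).trans ?_
  refine Finset.sum_le_sum fun i _ => ?_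
  refine (totalDegree_pow _ _).trans ?_
  have := hg i
  nlinarith

theorem totalDegree_of_mul_le {n d : ℕ} (p f : MvPolynomial (Fin n) K) (hp : p ≠ 0)
    (hp1 : p.totalDegree = 1) (h : (p * f).totalDegree ≤ d + 1) : f.totalDegree ≤ d := by
  by_cases hf : f = 0
  · subst hf; simp
  · rw [totalDegree_mul_of_isDomain hp hf] at h
    omega

theorem deg_X_sub_C {n : ℕ} (i : Fin n) (c : K) :
    (X i - C c : MvPolynomial (Fin n) K).totalDegree = 1 ∧
      (X i - C c : MvPolynomial (Fin n) K) ≠ 0 := by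
  have h1 : (X i - C c : MvPolynomial (Fin n) K).totalDegree = 1 := by
    rw [sub_eq_add_neg, totalDegree_add_eq_left_of_totalDegree_lt, totalDegree_X]
    rw [totalDegree_neg, totalDegree_C, totalDegree_X]; norm_num
  refine ⟨h1, fun h => ?_⟩
  rw [h] at h1
  simp at h1

theorem deg_X_sub_X {n : ℕ} (i j : Fin n) (hij : i ≠ j) :
    (X i - X j : MvPolynomial (Fin n) K).totalDegree = 1 ∧
      (X i - X j : MvPolynomial (Fin n) K) ≠ 0 := by
  have h0 : (X i - X j : MvPolynomial (Fin n) K) ≠ 0 := by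
    rw [sub_ne_zero]
    exact fun h => hij (X_injective h)
  refine ⟨?_, h0⟩
  refine IsHomogeneous.totalDegree ?_ h0
  exact (isHomogeneous_X _ _).sub (isHomogeneous_X _ _)

/-! ### The shift `ω` -/

/-- `(ω f)(x) = f(x_2, …, x_n, x_1 / q)`. -/
def omg {n : ℕ} : MvPolynomial (Fin (n + 1)) K →ₐ[K] MvPolynomial (Fin (n + 1)) K :=
  aeval (Fin.snoc (fun i : Fin n => X i.succ) (C qq⁻¹ * X 0) :
    Fin (n + 1) → MvPolynomial (Fin (n + 1)) K)

/-- The inverse of `ω`. -/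
def omgInv {n : ℕ} : MvPolynomial (Fin (n + 1)) K →ₐ[K] MvPolynomial (Fin (n + 1)) K :=
  aeval (Fin.cons (C qq * X (Fin.last n)) (fun i : Fin n => X i.castSucc) :
    Fin (n + 1) → MvPolynomial (Fin (n + 1)) K)

theorem omg_omgInv {n : ℕ} (f : MvPolynomial (Fin (n + 1)) K) : omg (omgInv f) = f := by
  have : (omg (n := n)).comp omgInv = AlgHom.id K _ := by
    apply algHom_ext
    intro i
    refine Fin.cases ?_ (fun i => ?_) i
    · simp [omg, omgInv, ← mul_assoc, ← C_mul, mul_inv_cancel₀ qq_ne, algHom_C]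
    · simp [omg, omgInv]
  exact DFunLike.congr_fun this f

theorem deg_omg {n : ℕ} (f : MvPolynomial (Fin (n + 1)) K) :
    (omg f).totalDegree ≤ f.totalDegree := by
  refine totalDegree_aeval_le _ (fun i => ?_) f
  refine Fin.lastCases ?_ (fun i => ?_) i
  · simp only [Fin.snoc_last]
    refine (totalDegree_mul _ _).trans ?_
    simp
  · simp

theorem deg_omgInv {n : ℕ} (f : MvPolynomial (Fin (n + 1)) K) :
    (omgInv f).totalDegree ≤ f.totalDegree := by
  refine totalDegree_aeval_le _ (fun i => ?_) f
  refine Fin.cases ?_ (fun i => ?_) i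
  · simp only [Fin.cons_zero]
    refine (totalDegree_mul _ _).trans ?_
    simp
  · simp

theorem eval_omg {n : ℕ} (y : Fin (n + 1) → K) (f : MvPolynomial (Fin (n + 1)) K) :
    eval y (omg f) = eval (Fin.snoc (fun i : Fin n => y i.succ) (qq⁻¹ * y 0) :
      Fin (n + 1) → K) f := by
  unfold omg
  rw [eval_aeval']
  congr 2
  funext i
  refine Fin.lastCases ?_ (fun i => ?_) i <;> simp

theorem eval_Phi_omg {n : ℕ} (κ : Fin (n + 1) → ℕ) (f : MvPolynomial (Fin (n + 1)) K) :
    eval (evalPt (Phi κ)) (omg f) = eval (evalPt κ) f := by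
  rw [eval_omg, evalPt_Phi]
  congr 2
  funext i
  refine Fin.lastCases ?_ (fun i => ?_) i
  · simp [← mul_assoc, inv_mul_cancel₀ qq_ne]
  · simp

/-! ### The peeling lemma and uniqueness -/

/-- Degree at most `d`, vanishing at all points of size `< d`, and at those of size `d`
outside of `S`. -/
def WS {n : ℕ} (d : ℕ) (S : (Fin n → ℕ) → Prop) (f : MvPolynomial (Fin n) K) : Prop :=
  f.totalDegree ≤ d ∧ ∀ η : Fin n → ℕ, csize η ≤ d → (csize η = d → ¬ S η) →
    eval (evalPt η) f = 0

theorem csize_cons {n : ℕ} (η : Fin n → ℕ) :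
    csize (Fin.cons 0 η : Fin (n + 1) → ℕ) = csize η := by
  simp [csize, Fin.sum_univ_succ]

theorem eval_X_sub {n : ℕ} (y : Fin (n + 1) → K) (c : K) (g : MvPolynomial (Fin (n + 1)) K) :
    eval y ((X 0 - C c) * g) = (y 0 - c) * eval y g := by simp

theorem uniq_step {n d : ℕ}
    (U : ∀ f : MvPolynomial (Fin n) K, f.totalDegree ≤ d →
      (∀ η : Fin n → ℕ, csize η ≤ d → eval (evalPt η) f = 0) → f = 0)
    (f : MvPolynomial (Fin (n + 1)) K) (hd : f.totalDegree ≤ d)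
    (h : ∀ η : Fin (n + 1) → ℕ, csize η ≤ d → η 0 = 0 → eval (evalPt η) f = 0) :
    (X 0 - C (tt ^ (-(n : ℤ)))) ∣ f := by
  apply dvd_of_vanish
  let g : Fin (n + 1) → MvPolynomial (Fin n) K := Fin.cons (C (tt ^ (-(n : ℤ)))) X
  have e : ∀ y : Fin n → K, eval y (aeval g f) =
      eval (Fin.cons (tt ^ (-(n : ℤ))) y : Fin (n + 1) → K) f := by
    intro y
    rw [eval_aeval']
    congr 2
    funext i
    refine Fin.cases ?_ (fun i => ?_) i <;> simp [g]
  have h0 : aeval g f = 0 := by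
    apply U
    · refine (totalDegree_aeval_le _ (fun i => ?_) f).trans hd
      refine Fin.cases ?_ (fun i => ?_) i <;> simp [g]
    · intro η hη
      rw [e, ← evalPt_cons]
      exact h _ (by rw [csize_cons]; exact hη) (by simp)
  intro y
  rw [← e, h0, map_zero]

theorem peel_aux {n : ℕ} (f : MvPolynomial (Fin (n + 1)) K)
    (h : (X 0 - C (tt ^ (-(n : ℤ)))) ∣ f) :
    ∃ g, f = (X 0 - C (tt ^ (-(n : ℤ)))) * omg g ∧
      (∀ d, f.totalDegree ≤ d + 1 → g.totalDegree ≤ d) ∧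
      ∀ κ, eval (evalPt (Phi κ)) f = 0 → eval (evalPt κ) g = 0 := by
  obtain ⟨f', hf'⟩ := h
  refine ⟨omgInv f', ?_, ?_, ?_⟩
  · rw [omg_omgInv, hf']
  · intro d hd
    refine (deg_omgInv _).trans ?_
    rw [hf'] at hd
    exact totalDegree_of_mul_le _ _ (deg_X_sub_C _ _).2 (deg_X_sub_C _ _).1 hd
  · intro κ hκ
    rw [hf', eval_X_sub] at hκ
    have : evalPt (Phi κ) 0 - tt ^ (-(n : ℤ)) ≠ 0 :=
      sub_ne_zero.mpr (evalPt_zero_ne _ (by simp [Phi]))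
    have h2 := (mul_eq_zero.mp hκ).resolve_left this
    rw [← eval_Phi_omg, omg_omgInv]
    exact h2

theorem uniq : ∀ (n d : ℕ) (f : MvPolynomial (Fin n) K), f.totalDegree ≤ d →
    (∀ η : Fin n → ℕ, csize η ≤ d → eval (evalPt η) f = 0) → f = 0 := by
  intro n
  induction n with
  | zero =>
    intro d f _ h
    apply MvPolynomial.funext
    intro x
    rw [map_zero, ← h 0 (by simp [csize])]
    congr 2
    exact Subsingleton.elim _ _
  | succ n ihn =>
    intro d
    induction d with
    | zero =>
      intro f hd h
      have h2 := h 0 (by simp [csize])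
      rw [Nat.le_zero, totalDegree_eq_zero_iff_eq_C] at hd
      rw [hd] at h2 ⊢
      simpa using h2
    | succ d ihd =>
      intro f hd h
      obtain ⟨g, hg, hgd, hgv⟩ := peel_aux f (uniq_step (ihn (d + 1)) f hd (fun η hη _ => h η hη))
      have : g = 0 := by
        apply ihd g (hgd d hd)
        intro κ hκ
        apply hgv
        apply h
        rw [csize_Phi]; omega
      rw [hg, this]; simp

theorem peel {n d : ℕ} (S : (Fin (n + 1) → ℕ) → Prop) (hS : ∀ η, S η → η 0 ≠ 0)
    (f : MvPolynomial (Fin (n + 1)) K) (hf : WS (d + 1) S f) :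
    ∃ g, f = (X 0 - C (tt ^ (-(n : ℤ)))) * omg g ∧ WS d (fun κ => S (Phi κ)) g := by
  obtain ⟨g, hg, hgd, hgv⟩ := peel_aux f (uniq_step (uniq n (d + 1)) f hf.1
    (fun η hη h0 => hf.2 η hη fun _ hs => hS η hs h0))
  refine ⟨g, hg, hgd d hf.1, fun κ hκ hκ2 => hgv κ (hf.2 _ ?_ ?_)⟩
  · rw [csize_Phi]; omega
  · rw [csize_Phi]
    intro h
    exact hκ2 (by omega)

/-! ### Hecke operators -/

theorem eval_swapVars {n : ℕ} (i j : Fin n) (f : MvPolynomial (Fin n) K) (y : Fin n → K) :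
    eval y (swapVars i j f) = eval (y ∘ Equiv.swap i j) f := by
  unfold swapVars
  rw [eval_rename]

theorem csize_swap {n : ℕ} (η : Fin n → ℕ) (σ : Equiv.Perm (Fin n)) :
    csize (η ∘ σ) = csize η := by
  unfold csize
  exact Equiv.sum_comp σ η

theorem WS.mono {n d : ℕ} {S S' : (Fin n → ℕ) → Prop} {f : MvPolynomial (Fin n) K}
    (h : WS d S f) (hS : ∀ η, S η → S' η) : WS d S' f :=
  ⟨h.1, fun η hη h2 => h.2 η hη fun h3 h4 => h2 h3 (hS η h4)⟩

theorem WS.smul {n d : ℕ} {S : (Fin n → ℕ) → Prop} {f : MvPolynomial (Fin n) K}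
    (h : WS d S f) (c : K) : WS d S (C c * f) := by
  refine ⟨?_, fun η hη h2 => by rw [map_mul, h.2 η hη h2, mul_zero]⟩
  refine (totalDegree_mul _ _).trans ?_
  simpa using h.1

theorem WS.zero {n d : ℕ} {S : (Fin n → ℕ) → Prop} : WS d S (0 : MvPolynomial (Fin n) K) :=
  ⟨by simp, fun η _ _ => by simp⟩

theorem WS.sub {n d : ℕ} {S : (Fin n → ℕ) → Prop} {f g : MvPolynomial (Fin n) K}
    (hf : WS d S f) (hg : WS d S g) : WS d S (f - g) :=
  ⟨(totalDegree_sub _ _).trans (max_le hf.1 hg.1), fun η hη h2 => by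
    rw [map_sub, hf.2 η hη h2, hg.2 η hη h2, sub_zero]⟩

theorem WS.sum {n d : ℕ} {S : (Fin n → ℕ) → Prop} {ι : Type} (s : Finset ι)
    (f : ι → MvPolynomial (Fin n) K)
    (hf : ∀ i ∈ s, WS d S (f i)) : WS d S (∑ i ∈ s, f i) :=
  ⟨totalDegree_finsetSum_le fun i hi => (hf i hi).1, fun η hη h2 => by
    rw [map_sum]
    exact Finset.sum_eq_zero fun i hi => (hf i hi).2 η hη h2⟩

theorem WS.hecke {n d : ℕ} {S : (Fin n → ℕ) → Prop} {f : MvPolynomial (Fin n) K}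
    (h : WS d S f) (a b : Fin n) (hab : (a : ℕ) + 1 = b) :
    WS d (fun η => S η ∨ S (η ∘ Equiv.swap a b)) (_root_.hecke a b f) := by
  have hne : a ≠ b := by
    intro h
    rw [h] at hab
    omega
  have hspec := exactDiv_spec a b f
  unfold _root_.hecke
  set e := exactDiv (f - swapVars a b f) (X a - X b) with he
  constructor
  · have hds : (f - swapVars a b f).totalDegree ≤ d := by
      refine (totalDegree_sub _ _).trans (max_le h.1 ?_)
      exact (totalDegree_rename_le _ _).trans h.1
    refine (totalDegree_sub _ _).trans (max_le ?_ ?_)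
    · refine (totalDegree_mul _ _).trans ?_
      simpa using h.1
    · by_cases he0 : e = 0
      · simp [he0]
      · rw [hspec, totalDegree_mul_of_isDomain (deg_X_sub_X a b hne).2 he0,
          (deg_X_sub_X a b hne).1] at hds
        refine (totalDegree_mul _ _).trans ?_
        refine le_trans (Nat.add_le_add_right ?_ _) hds
        refine (totalDegree_sub _ _).trans (max_le ?_ ?_)
        · refine (totalDegree_mul _ _).trans ?_
          simp
        · simp
  · intro η hη hS
    have h1 : eval (evalPt η) f = 0 := h.2 η hη fun h3 h4 => hS h3 (Or.inl h4)
    simp only [map_sub, map_mul, eval_C, eval_X, h1, mul_zero, zero_sub, neg_eq_zero]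
    by_cases heq : η a = η b
    · rw [evalPt_eq η a b hab heq]; simp
    · have h2 : eval (evalPt (η ∘ Equiv.swap a b)) f = 0 :=
        h.2 _ (by rw [csize_swap]; exact hη) fun h3 h4 =>
          hS (by rw [← h3, csize_swap]) (Or.inr h4)
      have h3 := congrArg (eval (evalPt η)) hspec
      rw [map_sub, eval_swapVars, evalPt_swap η a b hab heq, h1, h2, map_mul] at h3
      simp only [map_sub, eval_X, sub_zero] at h3
      have h4 := (mul_eq_zero.mp h3.symm).resolve_left (sub_ne_zero.mpr (evalPt_adj_ne η a b hab))
      rw [h4, mul_zero]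

theorem eval_hecke_zero {n : ℕ} (a b : Fin n) (f : MvPolynomial (Fin n) K) (y : Fin n → K)
    (hy : y b = 0) : eval y (hecke a b f) = tt * eval (y ∘ Equiv.swap a b) f := by
  have hspec := congrArg (eval y) (exactDiv_spec a b f)
  unfold hecke
  set e := exactDiv (f - swapVars a b f) (X a - X b) with he
  rw [map_sub, eval_swapVars] at hspec
  simp only [map_sub, map_mul, eval_C, eval_X, hy, sub_zero] at hspec ⊢
  linear_combination tt * hspec

/-- `T_{j-1} ⋯ T_0 f` (0-indexed). -/
def Tup {n : ℕ} : ℕ → MvPolynomial (Fin (n + 1)) K → MvPolynomial (Fin (n + 1)) K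
  | 0, f => f
  | j + 1, f => if h : j + 1 < n + 1 then
      hecke ⟨j, Nat.lt_of_succ_lt h⟩ ⟨j + 1, h⟩ (Tup j f) else Tup j f

/-- Insert `0` in front, shifting the entries before position `j`. -/
def cyc {n : ℕ} (j : ℕ) (y : Fin (n + 1) → K) : Fin (n + 1) → K :=
  fun i => if (i : ℕ) = 0 then 0 else
    if (i : ℕ) ≤ j then y ⟨(i : ℕ) - 1, lt_of_le_of_lt (Nat.sub_le _ _) i.2⟩ else y i

theorem eval_Tup {n : ℕ} (f : MvPolynomial (Fin (n + 1)) K) : ∀ (j : ℕ) (hj : j < n + 1)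
    (y : Fin (n + 1) → K), y ⟨j, hj⟩ = 0 → eval y (Tup j f) = tt ^ j * eval (cyc j y) f := by
  intro j
  induction j with
  | zero =>
    intro hj y hy
    simp only [Tup, pow_zero, one_mul]
    congr 2
    funext i
    unfold cyc
    split_ifs with h1 h2
    · rw [← hy]; congr 1; exact Fin.ext h1
    · omega
    · rfl
  | succ j ih =>
    intro hj y hy
    simp only [Tup, dif_pos hj]
    rw [eval_hecke_zero _ _ _ _ hy, ih (by omega) _ (by simp [hy]), pow_succ, ← mul_assoc,
      mul_comm tt]
    congr 3
    funext i
    unfold cyc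
    simp only [Function.comp]
    by_cases h0 : (i : ℕ) = 0
    · simp [h0]
    simp only [h0, if_false]
    by_cases h1 : (i : ℕ) ≤ j
    · rw [if_pos h1, if_pos (by omega), Equiv.swap_apply_of_ne_of_ne] <;>
        simp only [ne_eq, Fin.ext_iff] <;> omega
    · rw [if_neg h1]
      by_cases h2 : (i : ℕ) = j + 1
      · rw [if_pos h2.le]
        have : i = ⟨j + 1, hj⟩ := Fin.ext h2
        subst this
        rw [Equiv.swap_apply_right]
        rfl
      · rw [if_neg (by omega), Equiv.swap_apply_of_ne_of_ne] <;>
          simp only [ne_eq, Fin.ext_iff] <;> omega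

theorem WS_Tup {n d m : ℕ} (f : MvPolynomial (Fin (n + 1)) K)
    (hf : WS d (fun η => ∀ i : Fin (n + 1), (i : ℕ) < m + 1 → η i = 0) f) (j : ℕ) :
    WS d (fun η => ∀ i : Fin (n + 1), (i : ℕ) < (if j < m + 1 then m + 1 else m) → η i = 0)
      (Tup j f) := by
  induction j with
  | zero => simpa [Tup] using hf
  | succ j ih =>
    simp only [Tup]
    by_cases h1 : j + 1 < n + 1 <;> by_cases h2 : j + 1 < m + 1 <;>
      simp only [h1, h2, dif_pos, dif_neg, if_true, if_false, not_false_eq_true]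
    · rw [if_pos (by omega)] at ih
      refine (ih.hecke _ _ rfl).mono ?_
      rintro η (h | h)
      · exact h
      · intro i hi
        have := h (Equiv.swap ⟨j, Nat.lt_of_succ_lt h1⟩ ⟨j + 1, h1⟩ i) (by
          rw [Equiv.swap_apply_def]
          split_ifs <;> simp <;> omega)
        simpa using this
    · refine (ih.hecke _ _ rfl).mono ?_
      rintro η (h | h)
      · intro i hi
        exact h i (by split_ifs <;> omega)
      · intro i hi
        have hij : i ≠ ⟨j + 1, h1⟩ := by
          intro hh
          rw [hh] at hi
          simp at hi
          omega
        by_cases hj : i = ⟨j, Nat.lt_of_succ_lt h1⟩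
        · rw [hj] at hi
          simp at hi
          omega
        · have := h i (by split_ifs <;> omega)
          simpa [Equiv.swap_apply_of_ne_of_ne hj hij] using this
    · rw [if_pos (by omega)] at ih
      exact ih
    · refine ih.mono fun η h i hi => h i (by split_ifs <;> omega)

theorem WS_Tup_true {n d : ℕ} (f : MvPolynomial (Fin (n + 1)) K)
    (hf : WS d (fun _ => True) f) (j : ℕ) : WS d (fun _ => True) (Tup j f) := by
  induction j with
  | zero => simpa [Tup] using hf
  | succ j ih =>
    simp only [Tup]
    split_ifs with h
    · exact (ih.hecke _ _ rfl).mono fun _ _ => trivial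
    · exact ih

/-- The eigenvalue equation `ω T_{n-1} ⋯ T_1 f = t^{n-1} f` for `f` supported on `η_1 = 0`. -/
theorem eigen {n d : ℕ} (f : MvPolynomial (Fin (n + 1)) K)
    (hf : WS d (fun η => η 0 = 0) f) : omg (Tup n f) = C (tt ^ n) * f := by
  have hT := WS_Tup_true f (hf.mono fun _ _ => trivial) n
  set D := omg (Tup n f) - C (tt ^ n) * f with hD
  have hDd : D.totalDegree ≤ d := by
    refine (totalDegree_sub _ _).trans (max_le ((deg_omg _).trans hT.1) ?_)
    exact (hf.smul _).1
  have hdvd : (X 0 - C (0 : K)) ∣ D := by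
    apply dvd_of_vanish
    intro y
    rw [hD, map_sub, map_mul, eval_C, eval_omg, eval_Tup f n (Nat.lt_succ_self n), sub_eq_zero]
    · congr 3
      funext i
      refine Fin.cases ?_ (fun i => ?_) i
      · simp [cyc]
      · have hi : (i : ℕ) + 1 ≤ n := i.2
        simp only [cyc, Fin.val_succ, Nat.add_eq_zero_iff, one_ne_zero, and_false, if_false, hi,
          if_true, Fin.cons_succ, Fin.cons_zero, mul_zero, Nat.add_sub_cancel]
        exact Fin.snoc_castSucc (α := fun _ => K) (0 : K) y i
    · have : (⟨n, Nat.lt_succ_self n⟩ : Fin (n + 1)) = Fin.last n := rfl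
      rw [this]
      simp
  obtain ⟨D', hD'⟩ := hdvd
  have hvan : ∀ η : Fin (n + 1) → ℕ, csize η ≤ d → η 0 ≠ 0 → eval (evalPt η) D' = 0 := by
    intro η hη h0
    have h1 : eval (evalPt η) D = 0 := by
      rw [hD, map_sub, map_mul, hf.2 η hη (fun _ => h0)]
      obtain ⟨κ, rfl⟩ := exists_Phi η h0
      rw [csize_Phi] at hη
      rw [eval_Phi_omg, hT.2 κ (by omega) (fun h => by omega)]
      simp
    rw [hD', eval_X_sub, sub_zero] at h1
    exact (mul_eq_zero.mp h1).resolve_left (evalPt_ne_zero _ _)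
  have hz : (X 0 - C (tt ^ (-(n : ℤ)))) * D' = 0 := by
    apply uniq (n + 1) d
    · by_cases hD0 : D' = 0
      · simp [hD0]
      · rw [totalDegree_mul_of_isDomain (deg_X_sub_C _ _).2 hD0, (deg_X_sub_C _ _).1]
        rw [hD', totalDegree_mul_of_isDomain (deg_X_sub_C _ _).2 hD0, (deg_X_sub_C _ _).1] at hDd
        exact hDd
    · intro η hη
      rw [eval_X_sub]
      by_cases h0 : η 0 = 0
      · rw [evalPt_zero η h0]; simp
      · rw [hvan η hη h0, mul_zero]
  have hD0 := (mul_eq_zero.mp hz).resolve_left (deg_X_sub_C _ _).2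
  rw [hD0, mul_zero, hD, sub_eq_zero] at hD'
  exact hD'

theorem unshift {n d : ℕ} : ∀ (m : ℕ) (g : MvPolynomial (Fin (n + 1)) K),
    WS d (fun η => ∀ i : Fin (n + 1), (i : ℕ) < m → η i = 0) g → m ≤ n + 1 →
    ∃ G, g = (omg (n := n))^[m] G ∧ WS d (fun _ => True) G := by
  intro m
  induction m with
  | zero =>
    intro g hg _
    exact ⟨g, rfl, hg.mono fun _ _ => trivial⟩
  | succ m ih =>
    intro g hg hm
    have h1 := eigen g (hg.mono fun η h => h 0 (by simp))
    have h2 : WS d (fun η => ∀ i : Fin (n + 1), (i : ℕ) < m → η i = 0)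
        (C (tt ^ n)⁻¹ * Tup n g) := by
      refine ((WS_Tup g hg n).smul _).mono fun η h i hi => h i ?_
      split_ifs <;> omega
    obtain ⟨G, hG, hGW⟩ := ih _ h2 (by omega)
    refine ⟨G, ?_, hGW⟩
    rw [Function.iterate_succ_apply', ← hG, map_mul, h1, algHom_C, algebraMap_eq, ← mul_assoc,
      ← C_mul, inv_mul_cancel₀ (pow_ne_zero _ tt_ne), C_1, one_mul]

/-! ### Reduced words -/

theorem inv_step {n : ℕ} (i : {i : ℕ // i + 1 < n}) (σ : Equiv.Perm (Fin n)) (x y : Fin n)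
    (hxy : x < y) (h : (adjSwap i * σ) y < (adjSwap i * σ) x)
    (hne : ¬ ((σ x : ℕ) = i.1 ∧ (σ y : ℕ) = i.1 + 1)) : σ y < σ x := by
  have hxy' : (σ x : ℕ) ≠ σ y := fun hh => hxy.ne (σ.injective (Fin.ext hh))
  simp only [adjSwap, Equiv.Perm.mul_apply, Equiv.swap_apply_def] at h
  simp only [Fin.lt_def, Fin.ext_iff] at h ⊢
  split_ifs at h <;> (try simp only at h) <;> omega

theorem permLength_mul_le {n : ℕ} (i : {i : ℕ // i + 1 < n}) (σ : Equiv.Perm (Fin n)) :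
    permLength (adjSwap i * σ) ≤ permLength σ + 1 := by
  unfold permLength
  refine le_trans (Set.ncard_le_ncard (t := insert
    (σ.symm ⟨i.1, Nat.lt_of_succ_lt i.2⟩, σ.symm ⟨i.1 + 1, i.2⟩)
    {p : Fin n × Fin n | p.1 < p.2 ∧ σ p.2 < σ p.1}) ?_ (Set.toFinite _)) (Set.ncard_insert_le _ _)
  rintro ⟨x, y⟩ ⟨h1, h2⟩
  by_cases hne : (σ x : ℕ) = i.1 ∧ (σ y : ℕ) = i.1 + 1
  · left
    have e1 : σ x = ⟨i.1, Nat.lt_of_succ_lt i.2⟩ := Fin.ext hne.1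
    have e2 : σ y = ⟨i.1 + 1, i.2⟩ := Fin.ext hne.2
    rw [← e1, ← e2]; simp
  · right
    exact ⟨h1, inv_step i σ x y h1 h2 hne⟩

theorem permLength_mul_le' {n : ℕ} (i : {i : ℕ // i + 1 < n}) (σ : Equiv.Perm (Fin n))
    (hlt : ∀ x y : Fin n, (σ x : ℕ) = i.1 → (σ y : ℕ) = i.1 + 1 → y < x) :
    permLength (adjSwap i * σ) ≤ permLength σ := by
  unfold permLength
  refine Set.ncard_le_ncard ?_ (Set.toFinite _)
  rintro ⟨x, y⟩ ⟨h1, h2⟩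
  refine ⟨h1, inv_step i σ x y h1 h2 ?_⟩
  rintro ⟨h3, h4⟩
  exact absurd h1 (not_lt.mpr (hlt x y h3 h4).le)

theorem permLength_le_length {n : ℕ} (w : List {i : ℕ // i + 1 < n}) :
    permLength (w.map adjSwap).prod ≤ w.length := by
  induction w with
  | nil =>
    simp only [List.map_nil, List.prod_nil, List.length_nil, Nat.le_zero]
    unfold permLength
    rw [Set.ncard_eq_zero]
    ext p
    simp
    exact fun h => h.le
  | cons i w ih =>
    simp only [List.map_cons, List.prod_cons, List.length_cons]
    have := permLength_mul_le i (w.map adjSwap).prod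
    omega

theorem adjSwap_block {n : ℕ} (k : ℕ) (i : {i : ℕ // i + 1 < n}) (hi : i.1 + 1 ≠ k) (x : Fin n) :
    ((adjSwap i x : ℕ) < k) ↔ (x : ℕ) < k := by
  simp only [adjSwap, Equiv.swap_apply_def, Fin.ext_iff]
  split_ifs <;> (try simp only) <;> omega

theorem reduced_block {n : ℕ} (k : ℕ) (w : List {i : ℕ // i + 1 < n})
    (hr : w.length = permLength (w.map adjSwap).prod)
    (hb : ∀ x : Fin n, (((w.map adjSwap).prod x : Fin n) : ℕ) < k ↔ (x : ℕ) < k) :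
    ∀ i ∈ w, i.1 + 1 ≠ k := by
  induction w with
  | nil => simp
  | cons i w ih =>
    simp only [List.map_cons, List.prod_cons, List.length_cons] at hr hb
    set σ := (w.map adjSwap).prod with hσ
    have h1 := permLength_mul_le i σ
    have h2 := permLength_le_length w
    rw [← hσ] at h2
    have hi : i.1 + 1 ≠ k := by
      intro hk
      have h3 := permLength_mul_le' i σ (by
        intro x y hx hy
        have e1 : σ x = ⟨i.1, Nat.lt_of_succ_lt i.2⟩ := Fin.ext hx
        have e2 : σ y = ⟨i.1 + 1, i.2⟩ := Fin.ext hy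
        have b1 := hb x
        have b2 := hb y
        rw [Equiv.Perm.mul_apply, e1, adjSwap, Equiv.swap_apply_left] at b1
        rw [Equiv.Perm.mul_apply, e2, adjSwap, Equiv.swap_apply_right] at b2
        simp only at b1 b2
        rw [Fin.lt_def]
        omega)
      omega
    intro j hj
    rcases List.mem_cons.mp hj with rfl | hj
    · exact hi
    · refine ih (by omega) (fun x => ?_) j hj
      rw [← hb x, Equiv.Perm.mul_apply, adjSwap_block k i hi]

/-! ### Interpolation ASEP polynomials -/

theorem Estar_WS {n : ℕ} (l : Fin n → ℕ) : WS (csize l) (fun η => η = l) (Estar l) := by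
  unfold Estar
  split_ifs with h
  · obtain ⟨h1, _, h3⟩ := h.choose_spec
    refine ⟨h1, fun η hη h4 => h3 η hη fun h5 => ?_⟩
    exact h4 (by rw [h5]) h5
  · exact WS.zero

theorem Tword_WS {n d : ℕ} (S : (Fin n → ℕ) → Prop) (w : List {i : ℕ // i + 1 < n})
    (hS : ∀ i ∈ w, ∀ η, S (η ∘ adjSwap i) → S η)
    (f : MvPolynomial (Fin n) K) (hf : WS d S f) : WS d S (Tword w f) := by
  induction w with
  | nil => exact hf
  | cons i w ih =>
    have h1 := ih (fun j hj => hS j (List.mem_cons_of_mem _ hj))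
    refine (WS.hecke h1 ⟨i.1, Nat.lt_of_succ_lt i.2⟩ ⟨i.1 + 1, i.2⟩ rfl).mono ?_
    rintro η (h | h)
    · exact h
    · exact hS i List.mem_cons_self η h

theorem csize_sortDesc {n : ℕ} (κ : Fin n → ℕ) : csize (sortDesc κ) = csize κ := by
  unfold sortDesc
  split_ifs with h
  · obtain ⟨_, σ, hσ⟩ := h.choose_spec
    conv_rhs => rw [← hσ]
    unfold permAct
    rw [csize_swap]
  · rfl

theorem fstar_WS {n : ℕ} (κ : Fin n → ℕ) : WS (csize κ) (fun _ => True) (fstar κ) := by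
  have h0 : WS (csize κ) (fun _ => True) (Estar (sortDesc κ)) := by
    have := (Estar_WS (sortDesc κ)).mono (S' := fun _ => True) fun _ _ => trivial
    rwa [csize_sortDesc] at this
  unfold fstar Tsigma
  split_ifs with h
  · exact Tword_WS _ _ (fun _ _ _ _ => trivial) _ h0
  · exact h0

theorem packed_sortDesc {n : ℕ} (k : ℕ) (hkn : k ≤ n) (μ : Fin n → ℕ) (hμ : Packed k μ) :
    Packed k (sortDesc μ) := by
  unfold sortDesc
  split_ifs with h
  · obtain ⟨hp, σ, hσ⟩ := h.choose_spec
    set l := h.choose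
    have hcard : (Finset.univ.filter fun i => l i ≠ 0).card = k := by
      have h1 : (Finset.univ.filter fun i => l i ≠ 0).card =
          (Finset.univ.filter fun i => μ i ≠ 0).card := by
        refine Finset.card_equiv σ fun i => ?_
        have h5 : μ (σ i) = l i := by rw [← hσ]; simp [permAct]
        simp only [Finset.mem_filter, Finset.mem_univ, true_and]
        rw [h5]
      rw [h1]
      have h2 : (Finset.univ.filter fun i => μ i ≠ 0) =
          (Finset.univ.filter fun i : Fin n => (i : ℕ) < k) := by
        ext i
        simp only [Finset.mem_filter, Finset.mem_univ, true_and]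
        exact ⟨fun hi => by_contra fun h3 => hi ((hμ i).2 (not_lt.mp h3)), (hμ i).1⟩
      rw [h2, Fin.card_filter_val_lt]
      omega
    intro i
    constructor
    · intro hi h0
      have : (Finset.univ.filter fun i => l i ≠ 0) ⊆ Finset.Iio i := by
        intro j hj
        simp only [Finset.mem_filter, Finset.mem_univ, true_and, Finset.mem_Iio] at hj ⊢
        by_contra hij
        have := hp i j (not_lt.mp hij)
        omega
      have := Finset.card_le_card this
      rw [hcard, Fin.card_Iio] at this
      omega
    · intro hi
      by_contra h0
      have : Finset.Iic i ⊆ (Finset.univ.filter fun i => l i ≠ 0) := by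
        intro j hj
        simp only [Finset.mem_filter, Finset.mem_univ, true_and, Finset.mem_Iic] at hj ⊢
        have := hp j i hj
        omega
      have := Finset.card_le_card this
      rw [hcard, Fin.card_Iic] at this
      omega
  · exact hμ

theorem fstar_packed {n : ℕ} (k : ℕ) (hkn : k ≤ n) (μ : Fin n → ℕ) (hμ : Packed k μ) :
    WS (csize μ) (Packed k) (fstar μ) := by
  have hl := packed_sortDesc k hkn μ hμ
  have h0 : WS (csize μ) (Packed k) (Estar (sortDesc μ)) := by
    have := (Estar_WS (sortDesc μ)).mono (S' := Packed k) fun η h => by rw [h]; exact hl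
    rwa [csize_sortDesc] at this
  have hiff : ∀ ν : Fin n → ℕ, Packed k ν → ∀ x : Fin n, (x : ℕ) < k ↔ ν x ≠ 0 :=
    fun ν h x => ⟨(h x).1, fun h1 => by_contra fun h2 => h1 ((h x).2 (not_lt.mp h2))⟩
  have hblock : ∀ x : Fin n, ((sigmaMin (sortDesc μ) μ x : Fin n) : ℕ) < k ↔ (x : ℕ) < k := by
    unfold sigmaMin
    split_ifs with h
    · intro x
      have h1 := h.choose_spec.1
      rw [hiff μ hμ, hiff _ hl]
      have h2 := congrFun h1 (h.choose x)
      simp only [permAct, Function.comp, Equiv.symm_apply_apply] at h2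
      rw [h2]
      exact Iff.rfl
    · simp
  unfold fstar Tsigma
  split_ifs with h
  · obtain ⟨h1, h2⟩ := h.choose_spec
    refine Tword_WS _ _ (fun i hi η hη => ?_) _ h0
    have hik := reduced_block k h.choose (by rw [h1]; exact h2) (by rw [h1]; exact hblock) i hi
    intro x
    have h3 := hη (adjSwap i x)
    rw [adjSwap_block k i hik, ← not_lt, adjSwap_block k i hik, not_lt] at h3
    simpa [adjSwap] using h3
  · exact h0

/-! ### Iterating -/

theorem omg_iter_X {n : ℕ} (j : ℕ) : ∀ (i : ℕ) (h : i + j < n + 1),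
    (omg (n := n))^[j] (X ⟨i, by omega⟩) = X ⟨i + j, h⟩ := by
  induction j with
  | zero => intro i h; rfl
  | succ j ih =>
    intro i h
    rw [Function.iterate_succ_apply', ih i (by omega)]
    have e : (⟨i + j, by omega⟩ : Fin (n + 1)) = Fin.castSucc ⟨i + j, by omega⟩ := rfl
    rw [e, omg, aeval_X, Fin.snoc_castSucc]
    rfl

theorem omg_iter_C {n : ℕ} (j : ℕ) (c : K) : (omg (n := n))^[j] (C c) = C c := by
  induction j with
  | zero => rfl
  | succ j ih => rw [Function.iterate_succ_apply', ih, algHom_C, algebraMap_eq]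

theorem omg_iter_full {n : ℕ} (f : MvPolynomial (Fin (n + 1)) K) :
    (omg (n := n))^[n + 1] f = scaleQinv f := by
  have key : (omg (n := n)) ^ (n + 1) = aeval (fun j : Fin (n + 1) => C qq⁻¹ * X j) := by
    apply algHom_ext
    intro i
    rw [AlgHom.coe_pow, aeval_X]
    have hit : (omg (n := n))^[n + 1] (X i) =
        (omg (n := n))^[(i : ℕ)] ((omg (n := n))^[1] ((omg (n := n))^[n - i] (X i))) := by
      rw [← Function.iterate_add_apply, ← Function.iterate_add_apply]
      exact congrArg (fun m => (omg (n := n))^[m] (X i)) (by have := i.2; omega)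
    rw [hit]
    have h1 := omg_iter_X (n := n) (n - i) i (by have := i.2; omega)
    have h2 : (⟨(i : ℕ) + (n - i), by have := i.2; omega⟩ : Fin (n + 1)) = Fin.last n := by
      apply Fin.ext; simp; have := i.2; omega
    rw [h2] at h1
    rw [h1, Function.iterate_one, omg, aeval_X, Fin.snoc_last, ← omg, iterate_map_mul,
      omg_iter_C]
    have h3 := omg_iter_X (n := n) i 0 (by have := i.2; omega)
    congr 1
    refine Eq.trans h3 ?_
    congr 1
    apply Fin.ext; simp
  have := DFunLike.congr_fun key f
  rw [AlgHom.coe_pow] at this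
  exact this

theorem chain {n k d : ℕ} (hkn : k ≤ n + 1) (f : MvPolynomial (Fin (n + 1)) K)
    (hf : WS (d + k) (Packed k) f) : ∀ j, j ≤ k → ∃ g,
    f = (∏ i ∈ Finset.univ.filter (fun i : Fin (n + 1) => (i : ℕ) < j),
      (X i - C (tt ^ (-(n : ℤ))))) * (omg (n := n))^[j] g ∧
    WS (d + (k - j)) (fun η => ∀ i : Fin (n + 1), ((i : ℕ) + j < k → η i ≠ 0) ∧
      (k ≤ (i : ℕ) + j → (i : ℕ) + j < n + 1 → η i = 0)) g := by
  intro j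
  induction j with
  | zero =>
    intro _
    refine ⟨f, by simp, hf.mono fun η h i => ⟨fun hi => (h i).1 hi, fun hi _ => (h i).2 hi⟩⟩
  | succ j ih =>
    intro hj
    obtain ⟨g, hg, hgW⟩ := ih (by omega)
    have e : d + (k - j) = d + (k - (j + 1)) + 1 := by omega
    rw [e] at hgW
    obtain ⟨g', hg', hgW'⟩ := peel _ (fun η h => (h 0).1 (by simp; omega)) g hgW
    refine ⟨g', ?_, hgW'.mono ?_⟩
    · rw [hg, hg', iterate_map_mul, iterate_map_sub, omg_iter_C]
      have h1 := omg_iter_X (n := n) j 0 (by omega)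
      have h2 : (omg (n := n))^[j] (X 0) = X ⟨j, by omega⟩ := by
        refine Eq.trans h1 ?_
        congr 1
        apply Fin.ext; simp
      have h3 : (Finset.univ.filter (fun i : Fin (n + 1) => (i : ℕ) < j + 1)) =
          insert ⟨j, by omega⟩ (Finset.univ.filter (fun i : Fin (n + 1) => (i : ℕ) < j)) := by
        ext i
        simp only [Finset.mem_filter, Finset.mem_univ, true_and, Finset.mem_insert, Fin.ext_iff]
        omega
      rw [h2, h3, Finset.prod_insert (by simp), Function.iterate_succ_apply]
      ring
    · intro η h i
      constructor
      · intro hi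
        have := (h ⟨i + 1, by omega⟩).1 (by simp; omega)
        have e2 : (⟨i + 1, by omega⟩ : Fin (n + 1)) = Fin.succ ⟨i, by omega⟩ := rfl
        rw [e2] at this
        exact this
      · intro hi hi2
        have := (h ⟨i + 1, by omega⟩).2 (by simp; omega) (by simp; omega)
        have e2 : (⟨i + 1, by omega⟩ : Fin (n + 1)) = Fin.succ ⟨i, by omega⟩ := rfl
        rw [e2] at this
        exact this

/-! ### Top homogeneous components -/

theorem hc_X_sub {n d : ℕ} (i : Fin n) (c : K) (h : MvPolynomial (Fin n) K)
    (hd : h.totalDegree ≤ d) :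
    homogeneousComponent (d + 1) ((X i - C c) * h) = X i * homogeneousComponent d h := by
  rw [sub_mul, map_sub, homogeneousComponent_C_mul,
    homogeneousComponent_eq_zero (d + 1) h (by omega), mul_zero, sub_zero]
  ext m
  rw [coeff_homogeneousComponent, coeff_X_mul', coeff_X_mul']
  by_cases hi : i ∈ m.support
  · rw [if_pos hi, if_pos hi, coeff_homogeneousComponent]
    have h1 : m = (m - Finsupp.single i 1) + Finsupp.single i 1 := by
      rw [tsub_add_cancel_of_le]
      rw [Finsupp.single_le_iff]
      have := Finsupp.mem_support_iff.mp hi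
      omega
    have h2 : m.degree = (m - Finsupp.single i 1).degree + 1 := by
      conv_lhs => rw [h1]
      rw [map_add, Finsupp.degree_single]
    rw [h2]
    simp
  · rw [if_neg hi, if_neg hi]; simp

theorem hc_prod {n d : ℕ} (c : K) (s : Finset (Fin n)) (h : MvPolynomial (Fin n) K)
    (hd : h.totalDegree ≤ d) :
    ((∏ i ∈ s, (X i - C c)) * h).totalDegree ≤ d + s.card ∧
    homogeneousComponent (d + s.card) ((∏ i ∈ s, (X i - C c)) * h) =
      (∏ i ∈ s, X i) * homogeneousComponent d h := by
  induction s using Finset.induction_on with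
  | empty => simpa using hd
  | insert i s hi ih =>
    rw [Finset.prod_insert hi, Finset.prod_insert hi, Finset.card_insert_of_notMem hi, mul_assoc,
      mul_assoc, ← add_assoc]
    refine ⟨?_, ?_⟩
    · refine (totalDegree_mul _ _).trans ?_
      rw [(deg_X_sub_C i c).1]
      omega
    · rw [hc_X_sub i c _ ih.1, ih.2]

theorem coeff_scale {n : ℕ} (f : MvPolynomial (Fin n) K) (m : Fin n →₀ ℕ) :
    coeff m (scaleQinv f) = qq⁻¹ ^ m.degree * coeff m f := by
  have hm : ∀ (s : Fin n →₀ ℕ) (a : K),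
      scaleQinv (monomial s a) = monomial s (qq⁻¹ ^ s.degree * a) := by
    intro s a
    unfold scaleQinv
    rw [aeval_monomial]
    simp only [mul_pow]
    rw [Finsupp.prod_mul, monomial_eq, algebraMap_eq]
    have : (s.prod fun _ e => (C qq⁻¹ : MvPolynomial (Fin n) K) ^ e) = C (qq⁻¹ ^ s.degree) := by
      unfold Finsupp.prod
      rw [Finset.prod_pow_eq_pow_sum, ← C_pow]
      rfl
    rw [this, C_mul]
    ring
  have hs : scaleQinv f = ∑ s ∈ f.support, monomial s (qq⁻¹ ^ s.degree * coeff s f) := by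
    conv_lhs => rw [f.as_sum]
    have : ∀ p : MvPolynomial (Fin n) K, scaleQinv p =
      aeval (fun j : Fin n => C qq⁻¹ * X j) p := fun _ => rfl
    rw [this, map_sum]
    exact Finset.sum_congr rfl fun s _ => by rw [← this, hm]
  rw [hs, coeff_sum]
  simp only [coeff_monomial, Finset.sum_ite_eq']
  split_ifs with h
  · rfl
  · rw [notMem_support_iff.mp h, mul_zero]

theorem hc_scale {n d : ℕ} (f : MvPolynomial (Fin n) K) :
    homogeneousComponent d (scaleQinv f) = C (qq⁻¹ ^ d) * homogeneousComponent d f := by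
  ext m
  rw [coeff_C_mul, coeff_homogeneousComponent, coeff_homogeneousComponent, coeff_scale]
  split_ifs with h
  · rw [h]
  · simp

theorem eq_zero_of_hc {n d : ℕ} (f : MvPolynomial (Fin n) K) (hf : WS d (fun _ => True) f)
    (h : homogeneousComponent d f = 0) : f = 0 := by
  have hlt : ∀ m ∈ f.support, m.degree < d := by
    intro m hm
    have h1 : m.degree ≤ d := (le_totalDegree hm).trans hf.1
    refine lt_of_le_of_ne h1 fun h2 => ?_
    have h3 := congrArg (coeff m) h
    rw [coeff_homogeneousComponent, if_pos h2, coeff_zero] at h3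
    exact mem_support_iff.mp hm h3
  cases d with
  | zero =>
    rw [← support_eq_empty]
    exact Finset.eq_empty_of_forall_notMem fun m hm => absurd (hlt m hm) (by omega)
  | succ e =>
    refine uniq n e f ?_ fun η hη => hf.2 η (by omega) fun h => by omega
    exact Finset.sup_le fun m hm => Nat.lt_succ_iff.mp (hlt m hm)

theorem csize_decOne {n : ℕ} (μ ν : Fin n → ℕ) (hν : ν ∈ SnFinset (zeroOnes μ)) :
    csize (decOne ν) = csize (decOne μ) := by
  unfold SnFinset at hν
  rw [Finset.mem_image] at hν
  obtain ⟨σ, _, rfl⟩ := hν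
  have h1 : decOne (permAct σ (zeroOnes μ)) = decOne (zeroOnes μ) ∘ σ.symm := rfl
  rw [h1, csize_swap]
  unfold csize
  refine Finset.sum_congr rfl fun i _ => ?_
  simp only [decOne, zeroOnes]
  split_ifs <;> omega

theorem csize_packed {n : ℕ} (k : ℕ) (hkn : k ≤ n) (μ : Fin n → ℕ) (hμ : Packed k μ) :
    csize μ = csize (decOne μ) + k := by
  have h1 : (Finset.univ.filter fun i : Fin n => (i : ℕ) < k).card = k := by
    rw [Fin.card_filter_val_lt]; omega
  conv_rhs => rw [← h1]
  rw [Finset.card_filter]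
  unfold csize
  rw [← Finset.sum_add_distrib]
  refine Finset.sum_congr rfl fun i _ => ?_
  simp only [decOne]
  have := hμ i
  split_ifs with h
  · have := this.1 h
    omega
  · have := this.2 (not_lt.mp h)
    omega

/-- the recursion for `f*_μ` with `μ` packed. -/
theorem statement12 (n k : ℕ) (hk1 : 1 ≤ k) (hkn : k ≤ n)
    (μ : Fin n → ℕ) (hμ : Packed k μ) (a : (Fin n → ℕ) → K)
    (ha : fhom μ =
      (∏ i ∈ Finset.univ.filter (fun i : Fin n => (i : ℕ) < k), X i) *
        ∑ ν ∈ SnFinset (zeroOnes μ), C (a ν) * fhom (decOne ν)) :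
    fstar μ =
      (∏ i ∈ Finset.univ.filter (fun i : Fin n => (i : ℕ) < k),
          (X i - C (tt ^ (-(n : ℤ) + 1)))) *
        ∑ ν ∈ SnFinset (zeroOnes μ),
          C (a ν * qq ^ csize (decOne ν)) * scaleQinv (fstar (decOne ν)) := by
  obtain ⟨N, rfl⟩ : ∃ N, n = N + 1 := ⟨n - 1, by omega⟩
  have hexp : (-((N + 1 : ℕ) : ℤ) + 1) = -(N : ℤ) := by push_cast; ring
  rw [hexp]
  set d := csize (decOne μ) with hd
  have hsz := csize_packed k hkn μ hμ
  rw [← hd] at hsz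
  have hf := fstar_packed k hkn μ hμ
  rw [hsz] at hf
  obtain ⟨g, hg, hgW⟩ := chain hkn _ hf k le_rfl
  have hgW2 : WS d (fun η => ∀ i : Fin (N + 1), (i : ℕ) < N + 1 - k → η i = 0) g := by
    rw [Nat.sub_self, add_zero] at hgW
    exact hgW.mono fun η h i hi => (h i).2 (by omega) (by omega)
  obtain ⟨G, hG, hGW⟩ := unshift (N + 1 - k) g hgW2 (by omega)
  rw [hG, ← Function.iterate_add_apply, show k + (N + 1 - k) = N + 1 by omega,
    omg_iter_full] at hg
  set H := ∑ ν ∈ SnFinset (zeroOnes μ), C (a ν) * fstar (decOne ν) with hH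
  have hHW : WS d (fun _ => True) H := by
    refine WS.sum _ _ fun ν hν => ?_
    have := (fstar_WS (decOne ν)).smul (a ν)
    rwa [csize_decOne μ ν hν] at this
  have hcard : (Finset.univ.filter fun i : Fin (N + 1) => (i : ℕ) < k).card = k := by
    rw [Fin.card_filter_val_lt]; omega
  have hsd : (scaleQinv G).totalDegree ≤ d := by
    refine (totalDegree_aeval_le _ (fun i => ?_) G).trans hGW.1
    refine (totalDegree_mul _ _).trans ?_
    simp
  have htop := (hc_prod (tt ^ (-(N : ℤ)))
    (Finset.univ.filter fun i : Fin (N + 1) => (i : ℕ) < k) _ hsd).2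
  rw [hcard, ← hg, ← hsz, hc_scale] at htop
  have hHt : ∑ ν ∈ SnFinset (zeroOnes μ), C (a ν) * fhom (decOne ν) =
      homogeneousComponent d H := by
    rw [hH, map_sum]
    refine Finset.sum_congr rfl fun ν hν => ?_
    rw [homogeneousComponent_C_mul, fhom, csize_decOne μ ν hν]
  rw [hHt] at ha
  have hne : (∏ i ∈ Finset.univ.filter (fun i : Fin (N + 1) => (i : ℕ) < k),
      (X i : MvPolynomial (Fin (N + 1)) K)) ≠ 0 :=
    Finset.prod_ne_zero_iff.mpr fun i _ => X_ne_zero i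
  have heq : homogeneousComponent d H = C (qq⁻¹ ^ d) * homogeneousComponent d G :=
    mul_left_cancel₀ hne (ha.symm.trans htop)
  have hGH : G = C (qq ^ d) * H := by
    rw [← sub_eq_zero]
    refine eq_zero_of_hc _ (hGW.sub (hHW.smul _)) ?_
    rw [map_sub, homogeneousComponent_C_mul, heq, ← mul_assoc, ← C_mul, ← mul_pow,
      mul_inv_cancel₀ qq_ne, one_pow, C_1, one_mul, sub_self]
  rw [hg, hGH]
  congr 1
  unfold scaleQinv
  rw [map_mul, hH, map_sum, Finset.mul_sum, algHom_C, algebraMap_eq]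
  refine Finset.sum_congr rfl fun ν hν => ?_
  rw [map_mul, algHom_C, algebraMap_eq, csize_decOne μ ν hν, C_mul]
  ring
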